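/- For every α > 0 and x₀ > 0 there exists θ₀(x₀) > 0 such that for all 0 < θ < θ₀(x₀) the following holds: v^>(x₀) + R_{x₀} v^<(x₀) ≠ 0, (S^> v^<)(x₀) ≠ 0, and a solution w of w''(x) + c(x)^(−2) w(x) = 0 on [x₀, ∞) is a scalar multiple of S^> · v^< if and only if w'(x₀) · (v^>(x₀) + R_{x₀} v^<(x₀)) = w(x₀) · ((v^>)'(x₀) + R_{x₀} (v^<)'(x₀)); in particular (S^> v^<)'(x₀)/(S^> v^<)(x₀) = ((v^>)'(x₀) + R_{x₀}(v^<)'(x₀))/(v^>(x₀) + R_{x₀} v^<(x₀)). -/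

import Mathlib

open MeasureTheory Set Filter Topology

noncomputable section

/-- The wave speed profile `c(x) = (1 + θ (x₊)^α)^(-1/2)`. -/
def spd (α θ x : ℝ) : ℝ := (1 + θ * (max x 0) ^ α) ^ (-(1 / 2) : ℝ)

/-- The WKB amplitude `b(x) = c(x)^(1/2)`. -/
def amp (α θ x : ℝ) : ℝ := spd α θ x ^ ((1 : ℝ) / 2)

/-- The WKB phase `φ(x) = ∫₀ˣ c(y)⁻¹ dy`. -/
def phase (α θ x : ℝ) : ℝ := ∫ y in (0:ℝ)..x, (spd α θ y)⁻¹

/-- `M(x) = c(x)^(1/2) (c^(1/2))''(x)` for `x > 0`, and `0` for `x ≤ 0`. -/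
def Mfun (α θ x : ℝ) : ℝ :=
  if 0 < x then
    spd α θ x ^ ((1 : ℝ) / 2) * deriv (deriv (fun y => spd α θ y ^ ((1 : ℝ) / 2))) x
  else 0

/-- `M_{x₀} = ∫_{x₀}^∞ |M(x)| dx`. -/
def Mtail (α θ x₀ : ℝ) : ℝ := ∫ x in Ioi x₀, |Mfun α θ x|

/-- The Volterra operator `K_σ`. -/
def Kop (α θ x₀ σ : ℝ) (f : ℝ → ℂ) (x : ℝ) : ℂ :=
  (2 * Complex.I * (1 + Complex.I * (σ : ℂ)))⁻¹ *
    ((∫ y in x₀..x, (Mfun α θ y : ℂ) * f y *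
        Complex.exp (-2 * Complex.I * (1 + Complex.I * (σ : ℂ)) *
          ((phase α θ x - phase α θ y : ℝ) : ℂ))) +
      ∫ y in Ioi x, (Mfun α θ y : ℂ) * f y)

/-- The right-going WKB wave `v^> = b e^{-iφ}`. -/
def vplus (α θ x : ℝ) : ℂ := (amp α θ x : ℂ) * Complex.exp (-Complex.I * (phase α θ x : ℂ))

/-- The left-going WKB wave `v^< = b e^{iφ}`. -/
def vminus (α θ x : ℝ) : ℂ := (amp α θ x : ℂ) * Complex.exp (Complex.I * (phase α θ x : ℂ))

/-- `S` is a bounded continuous solution on `[x₀,∞)` of `S = e^{-2iφ} + K₀ S`. -/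
def IsVolterraSol (α θ x₀ : ℝ) (S : ℝ → ℂ) : Prop :=
  (∃ C, ∀ x ∈ Ici x₀, ‖S x‖ ≤ C) ∧ ContinuousOn S (Ici x₀) ∧
    ∀ x ∈ Ici x₀, S x = Complex.exp (-2 * Complex.I * (phase α θ x : ℂ)) + Kop α θ x₀ 0 S x

/-- `R_{x₀} = (2i)⁻¹ ∫_{x₀}^∞ M S^>`. -/
def Rx (α θ x₀ : ℝ) (S : ℝ → ℂ) : ℂ :=
  (2 * Complex.I)⁻¹ * ∫ x in Ioi x₀, (Mfun α θ x : ℂ) * S x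

theorem base_pos {α θ : ℝ} (hθ : 0 < θ) (x : ℝ) : 0 < 1 + θ * (max x 0) ^ α := by
  have : 0 ≤ (max x 0) ^ α := Real.rpow_nonneg (le_max_right _ _) _
  positivity

theorem spd_pos {α θ : ℝ} (hθ : 0 < θ) (x : ℝ) : 0 < spd α θ x :=
  Real.rpow_pos_of_pos (base_pos hθ x) _

theorem amp_pos {α θ : ℝ} (hθ : 0 < θ) (x : ℝ) : 0 < amp α θ x :=
  Real.rpow_pos_of_pos (spd_pos hθ x) _

theorem spd_eq_amp_sq {α θ : ℝ} (hθ : 0 < θ) (x : ℝ) : spd α θ x = amp α θ x ^ 2 := by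
  rw [amp, ← Real.rpow_natCast, ← Real.rpow_mul (spd_pos hθ x).le]
  norm_num

theorem amp_le_one {α θ : ℝ} (hθ : 0 < θ) (x : ℝ) : amp α θ x ≤ 1 := by
  refine Real.rpow_le_one (spd_pos hθ x).le ?_ (by norm_num)
  refine Real.rpow_le_one_of_one_le_of_nonpos ?_ (by norm_num)
  have : 0 ≤ (max x 0) ^ α := Real.rpow_nonneg (le_max_right _ _) _
  nlinarith

theorem continuous_spd {α θ : ℝ} (hα : 0 < α) (hθ : 0 < θ) : Continuous (spd α θ) := by
  unfold spd
  refine Continuous.rpow_const ?_ fun x => Or.inl (base_pos hθ x).ne'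
  exact continuous_const.add (continuous_const.mul
    ((continuous_id.max continuous_const).rpow_const fun _ => Or.inr hα.le))

theorem hasDerivAt_phase {α θ : ℝ} (hα : 0 < α) (hθ : 0 < θ) (x : ℝ) :
    HasDerivAt (phase α θ) (spd α θ x)⁻¹ x := by
  have h : Continuous fun y => (spd α θ y)⁻¹ :=
    (continuous_spd hα hθ).inv₀ fun y => (spd_pos hθ y).ne'
  exact h.integral_hasStrictDerivAt 0 x |>.hasDerivAt

/-- The fraction `θ x^α / (1 + θ x^α)`. -/
def frac (α θ x : ℝ) : ℝ := θ * x ^ α / (1 + θ * x ^ α)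

theorem frac_nonneg {α θ x : ℝ} (hθ : 0 < θ) (hx : 0 < x) : 0 ≤ frac α θ x := by
  unfold frac; positivity

theorem frac_le_one {α θ x : ℝ} (hθ : 0 < θ) (hx : 0 < x) : frac α θ x ≤ 1 := by
  have : 0 < x ^ α := by positivity
  unfold frac
  rw [div_le_one (by positivity)]
  linarith

theorem hasDerivAt_frac {α θ x : ℝ} (hθ : 0 < θ) (hx : 0 < x) :
    HasDerivAt (frac α θ) (α / x * frac α θ x * (1 - frac α θ x)) x := by
  have hp : 0 < x ^ α := by positivity
  have h1 : HasDerivAt (fun y => θ * y ^ α) (θ * (α * x ^ (α - 1))) x :=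
    (Real.hasDerivAt_rpow_const (Or.inl hx.ne')).const_mul θ
  have h2 := h1.fun_div (h1.const_add 1) (by positivity)
  refine h2.congr_deriv ?_
  rw [Real.rpow_sub_one hx.ne']
  unfold frac
  field_simp

/-- The derivative of `amp` on the positive half line. -/
def ampDeriv (α θ x : ℝ) : ℝ := -(α / 4) * amp α θ x * frac α θ x / x

/-- The second derivative of `amp` on the positive half line. -/
def ampDeriv₂ (α θ x : ℝ) : ℝ :=
  amp α θ x / x ^ 2 * (5 / 16 * α ^ 2 * frac α θ x ^ 2 - α / 4 * (α - 1) * frac α θ x)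

theorem amp_eq {α θ : ℝ} (hθ : 0 < θ) {x : ℝ} (hx : 0 < x) :
    amp α θ x = (1 + θ * x ^ α) ^ (-(1 / 4) : ℝ) := by
  rw [amp, spd, ← Real.rpow_mul (base_pos hθ x).le, max_eq_left hx.le]
  norm_num

theorem hasDerivAt_amp {α θ x : ℝ} (hθ : 0 < θ) (hx : 0 < x) :
    HasDerivAt (amp α θ) (ampDeriv α θ x) x := by
  have hp : 0 < x ^ α := by positivity
  have hu : 0 < 1 + θ * x ^ α := by positivity
  have h1 : HasDerivAt (fun y => 1 + θ * y ^ α) (θ * (α * x ^ (α - 1))) x :=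
    ((Real.hasDerivAt_rpow_const (Or.inl hx.ne')).const_mul θ).const_add 1
  have h2 := h1.rpow_const (p := (-(1 / 4) : ℝ)) (Or.inl hu.ne')
  have h3 : amp α θ =ᶠ[𝓝 x] fun y => (1 + θ * y ^ α) ^ (-(1 / 4) : ℝ) := by
    filter_upwards [lt_mem_nhds hx] with y hy using amp_eq hθ hy
  refine (h2.congr_of_eventuallyEq h3).congr_deriv ?_
  rw [ampDeriv, amp_eq hθ hx, Real.rpow_sub_one hx.ne', Real.rpow_sub_one hu.ne', frac]
  field_simp

theorem hasDerivAt_ampDeriv {α θ x : ℝ} (hθ : 0 < θ) (hx : 0 < x) :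
    HasDerivAt (ampDeriv α θ) (ampDeriv₂ α θ x) x := by
  have h := (((hasDerivAt_amp (α := α) hθ hx).const_mul (-(α / 4))).fun_mul
    (hasDerivAt_frac (α := α) hθ hx)).fun_div (hasDerivAt_id x) hx.ne'
  refine h.congr_deriv ?_
  simp only [id, ampDeriv, ampDeriv₂]
  field_simp
  ring

theorem Mfun_eq {α θ x : ℝ} (hθ : 0 < θ) (hx : 0 < x) :
    Mfun α θ x = amp α θ x * ampDeriv₂ α θ x := by
  rw [Mfun, if_pos hx]
  have h : deriv (fun y => spd α θ y ^ ((1 : ℝ) / 2)) =ᶠ[𝓝 x] ampDeriv α θ := by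
    filter_upwards [lt_mem_nhds hx] with y hy using (hasDerivAt_amp hθ hy).deriv
  rw [h.deriv_eq, (hasDerivAt_ampDeriv hθ hx).deriv]
  rfl

theorem continuousOn_Mfun {α θ : ℝ} (hθ : 0 < θ) : ContinuousOn (Mfun α θ) (Ioi 0) := by
  have ha : ContinuousOn (amp α θ) (Ioi 0) := fun x hx =>
    (hasDerivAt_amp hθ hx).continuousAt.continuousWithinAt
  have hf : ContinuousOn (frac α θ) (Ioi 0) := fun x hx =>
    (hasDerivAt_frac hθ hx).continuousAt.continuousWithinAt
  have h : ContinuousOn (fun x => amp α θ x * ampDeriv₂ α θ x) (Ioi 0) := by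
    unfold ampDeriv₂
    refine ha.mul ((ha.div (by fun_prop) fun x hx => ?_).mul (by fun_prop))
    exact pow_ne_zero _ (ne_of_gt hx)
  exact h.congr fun x hx => Mfun_eq hθ hx

theorem abs_Mfun_le {α θ x : ℝ} (hα : 0 < α) (hθ : 0 < θ) (hx : 0 < x) :
    |Mfun α θ x| ≤ (α ^ 2 + α) * frac α θ x * x ^ (-2 : ℝ) := by
  have hq := frac_nonneg (α := α) hθ hx
  have hq1 := frac_le_one (α := α) hθ hx
  have hb := amp_pos (α := α) hθ x
  have hb1 := amp_le_one (α := α) hθ x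
  have hx2 : x ^ (-2 : ℝ) = (x ^ 2)⁻¹ := by
    rw [Real.rpow_neg hx.le]; norm_num
  rw [Mfun_eq hθ hx, ampDeriv₂, hx2]
  set q := frac α θ x
  set b := amp α θ x
  have e : b * (b / x ^ 2 * (5 / 16 * α ^ 2 * q ^ 2 - α / 4 * (α - 1) * q)) =
      b ^ 2 * (q * (5 / 16 * α ^ 2 * q - α / 4 * (α - 1))) * (x ^ 2)⁻¹ := by
    field_simp
  rw [e, abs_mul, abs_mul, abs_mul, abs_of_nonneg hq, abs_of_nonneg (sq_nonneg b),
    abs_of_nonneg (by positivity : 0 ≤ (x ^ 2)⁻¹)]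
  have h1 : |5 / 16 * α ^ 2 * q - α / 4 * (α - 1)| ≤ α ^ 2 + α := by
    have : 0 ≤ α ^ 2 * q := by positivity
    have : α ^ 2 * q ≤ α ^ 2 := mul_le_of_le_one_right (by positivity) hq1
    rw [abs_le]; constructor <;> nlinarith
  have h2 : b ^ 2 ≤ 1 := pow_le_one₀ hb.le hb1
  refine mul_le_mul_of_nonneg_right ?_ (by positivity)
  calc b ^ 2 * (q * |5 / 16 * α ^ 2 * q - α / 4 * (α - 1)|)
      ≤ 1 * (q * (α ^ 2 + α)) := by gcongr
    _ = _ := by ring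

theorem integrableOn_const_mul_rpow_neg_two (C : ℝ) {x₀ : ℝ} (hx₀ : 0 < x₀) :
    IntegrableOn (fun x : ℝ => C * x ^ (-2 : ℝ)) (Ioi x₀) :=
  (integrableOn_Ioi_rpow_of_lt (by norm_num) hx₀).const_mul C

theorem abs_Mfun_le_const {α θ x : ℝ} (hα : 0 < α) (hθ : 0 < θ) (hx : 0 < x) :
    |Mfun α θ x| ≤ (α ^ 2 + α) * x ^ (-2 : ℝ) := by
  refine (abs_Mfun_le hα hθ hx).trans ?_
  have : 0 < x ^ (-2 : ℝ) := by positivity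
  gcongr
  exact mul_le_of_le_one_right (by positivity) (frac_le_one hθ hx)

theorem aestronglyMeasurable_Mfun {α θ x₀ : ℝ} (hθ : 0 < θ) (hx₀ : 0 < x₀) :
    AEStronglyMeasurable (Mfun α θ) (volume.restrict (Ioi x₀)) :=
  ((continuousOn_Mfun hθ).mono (Ioi_subset_Ioi hx₀.le)).aestronglyMeasurable measurableSet_Ioi

theorem integrableOn_Mfun {α θ x₀ : ℝ} (hα : 0 < α) (hθ : 0 < θ) (hx₀ : 0 < x₀) :
    IntegrableOn (Mfun α θ) (Ioi x₀) := by
  refine (integrableOn_const_mul_rpow_neg_two (α ^ 2 + α) hx₀).mono'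
    (aestronglyMeasurable_Mfun hθ hx₀) ?_
  filter_upwards [ae_restrict_mem measurableSet_Ioi] with x hx
  exact abs_Mfun_le_const hα hθ (hx₀.trans hx)

theorem tendsto_frac (α x : ℝ) : Tendsto (fun θ => frac α θ x) (𝓝[>] 0) (𝓝 0) := by
  have h : ContinuousAt (fun θ => frac α θ x) 0 := by
    unfold frac
    exact ContinuousAt.div (by fun_prop) (by fun_prop) (by simp)
  have := h.tendsto
  simp only [frac, zero_mul, zero_div] at this
  exact this.mono_left nhdsWithin_le_nhds

theorem tendsto_Mtail {α x₀ : ℝ} (hα : 0 < α) (hx₀ : 0 < x₀) :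
    Tendsto (fun θ => Mtail α θ x₀) (𝓝[>] 0) (𝓝 0) := by
  have h0 : (0 : ℝ) = ∫ _ in Ioi x₀, (0 : ℝ) := by simp
  unfold Mtail
  nth_rewrite 3 [h0]
  refine tendsto_integral_filter_of_dominated_convergence
    (fun x => (α ^ 2 + α) * x ^ (-2 : ℝ)) ?_ ?_
    (integrableOn_const_mul_rpow_neg_two (α ^ 2 + α) hx₀) ?_
  · filter_upwards [self_mem_nhdsWithin] with θ hθ
    exact (aestronglyMeasurable_Mfun hθ hx₀).norm
  · filter_upwards [self_mem_nhdsWithin] with θ hθ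
    filter_upwards [ae_restrict_mem measurableSet_Ioi] with x hx
    rw [Real.norm_eq_abs, abs_abs]
    exact abs_Mfun_le_const hα hθ (hx₀.trans hx)
  · filter_upwards [ae_restrict_mem measurableSet_Ioi] with x hx
    refine tendsto_of_tendsto_of_tendsto_of_le_of_le' (g := fun _ => 0)
      (h := fun θ => (α ^ 2 + α) * frac α θ x * x ^ (-2 : ℝ)) tendsto_const_nhds ?_
      (Eventually.of_forall fun _ => abs_nonneg _) ?_
    · simpa using ((tendsto_frac α x).const_mul (α ^ 2 + α)).mul_const (x ^ (-2 : ℝ))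
    · filter_upwards [self_mem_nhdsWithin] with θ hθ
      exact abs_Mfun_le hα hθ (hx₀.trans hx)

/-- The wave `b e^{sφ}`. -/
def wave (α θ : ℝ) (s : ℂ) (x : ℝ) : ℂ := (amp α θ x : ℂ) * Complex.exp (s * (phase α θ x : ℂ))

/-- The derivative of the wave `b e^{sφ}` on the positive half line. -/
def waveDeriv (α θ : ℝ) (s : ℂ) (x : ℝ) : ℂ :=
  ((ampDeriv α θ x : ℂ) + s / (amp α θ x : ℂ)) * Complex.exp (s * (phase α θ x : ℂ))

theorem hasDerivAt_exp_phase {α θ : ℝ} (hα : 0 < α) (hθ : 0 < θ) (s : ℂ) (x : ℝ) :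
    HasDerivAt (fun y => Complex.exp (s * (phase α θ y : ℂ)))
      (Complex.exp (s * (phase α θ x : ℂ)) * (s / (amp α θ x : ℂ) ^ 2)) x := by
  have h := ((hasDerivAt_phase hα hθ x).ofReal_comp.const_mul s).cexp
  refine h.congr_deriv ?_
  rw [spd_eq_amp_sq hθ]
  push_cast
  rfl

theorem hasDerivAt_wave {α θ x : ℝ} (hα : 0 < α) (hθ : 0 < θ) (hx : 0 < x) (s : ℂ) :
    HasDerivAt (wave α θ s) (waveDeriv α θ s x) x := by
  have ha : (amp α θ x : ℂ) ≠ 0 := by exact_mod_cast (amp_pos hθ x).ne'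
  refine ((hasDerivAt_amp hθ hx).ofReal_comp.mul (hasDerivAt_exp_phase hα hθ s x)).congr_deriv ?_
  rw [waveDeriv]
  field_simp

theorem hasDerivAt_waveDeriv {α θ x : ℝ} (hα : 0 < α) (hθ : 0 < θ) (hx : 0 < x) {s : ℂ}
    (hs : s ^ 2 = -1) :
    HasDerivAt (waveDeriv α θ s)
      (((ampDeriv₂ α θ x : ℂ) / (amp α θ x : ℂ) - ((spd α θ x : ℂ)⁻¹) ^ 2) * wave α θ s x) x := by
  have ha : (amp α θ x : ℂ) ≠ 0 := by exact_mod_cast (amp_pos hθ x).ne'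
  have h1 := ((hasDerivAt_const x s).fun_div (hasDerivAt_amp (α := α) hθ hx).ofReal_comp ha)
  refine (((hasDerivAt_ampDeriv (α := α) hθ hx).ofReal_comp.fun_add h1).fun_mul
    (hasDerivAt_exp_phase hα hθ s x)).congr_deriv ?_
  rw [wave, spd_eq_amp_sq hθ]
  push_cast
  field_simp
  linear_combination hs

theorem vminus_eq_wave (α θ : ℝ) : vminus α θ = wave α θ Complex.I := rfl

theorem vplus_eq_wave (α θ : ℝ) : vplus α θ = wave α θ (-Complex.I) := rfl

theorem continuous_Mfun_max {α θ x₀ : ℝ} (hθ : 0 < θ) (hx₀ : 0 < x₀) :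
    Continuous fun y => Mfun α θ (max x₀ y) :=
  (continuousOn_Mfun hθ).comp_continuous (by fun_prop) fun _ => lt_max_of_lt_left hx₀

theorem continuous_comp_max {x₀ : ℝ} {S : ℝ → ℂ} (hS : ContinuousOn S (Ici x₀)) :
    Continuous fun y => S (max x₀ y) :=
  hS.comp_continuous (by fun_prop) fun y => le_max_left x₀ y

/-- Two solutions of `w'' + V w = 0` on a half line with proportional initial data are
proportional when the second one does not vanish. -/
theorem eq_smul_of_wronskian {x₀ : ℝ} {V w w' w'' u u' u'' : ℝ → ℂ}
    (hw : ∀ x ∈ Ici x₀, HasDerivWithinAt w (w' x) (Ici x₀) x)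
    (hw' : ∀ x ∈ Ici x₀, HasDerivWithinAt w' (w'' x) (Ici x₀) x)
    (hwV : ∀ x ∈ Ici x₀, w'' x + V x * w x = 0)
    (hu : ∀ x ∈ Ici x₀, HasDerivWithinAt u (u' x) (Ici x₀) x)
    (hu' : ∀ x ∈ Ici x₀, HasDerivWithinAt u' (u'' x) (Ici x₀) x)
    (huV : ∀ x ∈ Ici x₀, u'' x + V x * u x = 0)
    (hne : ∀ x ∈ Ici x₀, u x ≠ 0) (h0 : w' x₀ * u x₀ = w x₀ * u' x₀) :
    ∀ x ∈ Ici x₀, w x = w x₀ / u x₀ * u x := by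
  have const : ∀ f : ℝ → ℂ, (∀ x ∈ Ici x₀, HasDerivWithinAt f 0 (Ici x₀) x) →
      ∀ x ∈ Ici x₀, f x = f x₀ := fun f hf x hx =>
    constant_of_has_deriv_right_zero
      (fun y hy => (hf y hy.1).continuousWithinAt.mono Icc_subset_Ici_self)
      (fun y hy => (hf y hy.1).mono (Ici_subset_Ici.2 hy.1)) x ⟨hx, le_rfl⟩
  have hW := const (fun x => w' x * u x - w x * u' x) fun x hx => by
    refine (((hw' x hx).fun_mul (hu x hx)).fun_sub
      ((hw x hx).fun_mul (hu' x hx))).congr_deriv ?_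
    linear_combination u x * hwV x hx - w x * huV x hx
  have hQ := const (fun x => w x / u x) fun x hx => by
    refine ((hw x hx).fun_div (hu x hx) (hne x hx)).congr_deriv ?_
    have := hW x hx
    simp only [h0, sub_self] at this
    rw [this, zero_div]
  intro x hx
  rw [← hQ x hx, div_mul_cancel₀ _ (hne x hx)]

theorem integrableOn_Mfun_mul {α θ x₀ C : ℝ} {S : ℝ → ℂ} (hα : 0 < α) (hθ : 0 < θ)
    (hx₀ : 0 < x₀) (hC : ∀ x ∈ Ici x₀, ‖S x‖ ≤ C) (hS : ContinuousOn S (Ici x₀)) :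
    IntegrableOn (fun y => (Mfun α θ y : ℂ) * S y) (Ioi x₀) := by
  refine (integrableOn_Mfun hα hθ hx₀).ofReal.mul_bdd (c := C)
    ((hS.mono Ioi_subset_Ici_self).aestronglyMeasurable measurableSet_Ioi) ?_
  filter_upwards [ae_restrict_mem measurableSet_Ioi] with x hx using hC x (Ioi_subset_Ici_self hx)

theorem Kop_zero (α θ x₀ : ℝ) (S : ℝ → ℂ) (x : ℝ) :
    Kop α θ x₀ 0 S x = (2 * Complex.I)⁻¹ *
      ((∫ y in x₀..x, (Mfun α θ y : ℂ) * S y *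
        Complex.exp (-2 * Complex.I * ((phase α θ x - phase α θ y : ℝ) : ℂ))) +
      ∫ y in Ioi x, (Mfun α θ y : ℂ) * S y) := by
  simp [Kop]

theorem norm_Kop_zero_le {α θ x₀ C : ℝ} {S : ℝ → ℂ} (hα : 0 < α) (hθ : 0 < θ)
    (hx₀ : 0 < x₀) (hC : ∀ x ∈ Ici x₀, ‖S x‖ ≤ C) {x : ℝ} (hx : x₀ ≤ x) :
    ‖Kop α θ x₀ 0 S x‖ ≤ Mtail α θ x₀ / 2 * C := by
  have hi : IntegrableOn (fun y => |Mfun α θ y| * C) (Ioi x₀) :=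
    ((integrableOn_Mfun hα hθ hx₀).abs).mul_const C
  have h1 : ‖∫ y in x₀..x, (Mfun α θ y : ℂ) * S y *
      Complex.exp (-2 * Complex.I * ((phase α θ x - phase α θ y : ℝ) : ℂ))‖ ≤
      ∫ y in Ioc x₀ x, |Mfun α θ y| * C := by
    rw [intervalIntegral.integral_of_le hx]
    refine norm_integral_le_of_norm_le (hi.mono_set Ioc_subset_Ioi_self) ?_
    filter_upwards [ae_restrict_mem measurableSet_Ioc] with y hy
    have e : -2 * Complex.I * ((phase α θ x - phase α θ y : ℝ) : ℂ) =
        ((-2 * (phase α θ x - phase α θ y) : ℝ) : ℂ) * Complex.I := by push_cast; ring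
    rw [e, norm_mul, norm_mul, Complex.norm_exp_ofReal_mul_I, mul_one, Complex.norm_real,
      Real.norm_eq_abs]
    gcongr
    exact hC y hy.1.le
  have h2 : ‖∫ y in Ioi x, (Mfun α θ y : ℂ) * S y‖ ≤ ∫ y in Ioi x, |Mfun α θ y| * C := by
    refine norm_integral_le_of_norm_le (hi.mono_set (Ioi_subset_Ioi hx)) ?_
    filter_upwards [ae_restrict_mem measurableSet_Ioi] with y hy
    rw [norm_mul, Complex.norm_real, Real.norm_eq_abs]
    gcongr
    exact hC y (hx.trans (le_of_lt hy))
  have h3 : (∫ y in Ioc x₀ x, |Mfun α θ y| * C) + ∫ y in Ioi x, |Mfun α θ y| * C =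
      Mtail α θ x₀ * C := by
    rw [← setIntegral_union (Ioc_disjoint_Ioi le_rfl) measurableSet_Ioi
      (hi.mono_set Ioc_subset_Ioi_self) (hi.mono_set (Ioi_subset_Ioi hx)),
      Ioc_union_Ioi_eq_Ioi hx, integral_mul_const, Mtail]
  rw [Kop_zero, norm_mul]
  have h4 : ‖(2 * Complex.I)⁻¹‖ = 1 / 2 := by simp
  rw [h4]
  refine (mul_le_mul_of_nonneg_left (norm_add_le _ _) (by norm_num)).trans ?_
  linarith

theorem IsVolterraSol.ne_zero {α θ x₀ : ℝ} {S : ℝ → ℂ} (hα : 0 < α) (hθ : 0 < θ)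
    (hx₀ : 0 < x₀) (hM : Mtail α θ x₀ < 1) (hS : IsVolterraSol α θ x₀ S) :
    ∀ x ∈ Ici x₀, S x ≠ 0 := by
  obtain ⟨⟨C, hC⟩, -, heq⟩ := hS
  have hM0 : 0 ≤ Mtail α θ x₀ := integral_nonneg fun _ => abs_nonneg _
  have hne : ((fun x => ‖S x‖) '' Ici x₀).Nonempty := ⟨_, x₀, self_mem_Ici, rfl⟩
  have hbdd : BddAbove ((fun x => ‖S x‖) '' Ici x₀) :=
    ⟨C, by rintro _ ⟨x, hx, rfl⟩; exact hC x hx⟩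
  set D := sSup ((fun x => ‖S x‖) '' Ici x₀)
  have hD : ∀ x ∈ Ici x₀, ‖S x‖ ≤ D := fun x hx => le_csSup hbdd ⟨x, hx, rfl⟩
  have hD0 : 0 ≤ D := (norm_nonneg _).trans (hD x₀ self_mem_Ici)
  have hexp : ∀ x, ‖Complex.exp (-2 * Complex.I * (phase α θ x : ℂ))‖ = 1 := fun x => by
    have e : -2 * Complex.I * (phase α θ x : ℂ) = ((-2 * phase α θ x : ℝ) : ℂ) * Complex.I := by
      push_cast; ring
    rw [e, Complex.norm_exp_ofReal_mul_I]
  have hK := fun {x} (hx : x₀ ≤ x) => norm_Kop_zero_le hα hθ hx₀ hD hx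
  have hD1 : D ≤ 1 + Mtail α θ x₀ / 2 * D := by
    refine csSup_le hne ?_
    rintro _ ⟨x, hx, rfl⟩
    have := norm_add_le (Complex.exp (-2 * Complex.I * (phase α θ x : ℂ))) (Kop α θ x₀ 0 S x)
    rw [← heq x hx, hexp] at this
    exact this.trans (by gcongr; exact hK hx)
  intro x hx h0
  have h1 := heq x hx
  rw [h0] at h1
  have h2 : ‖Kop α θ x₀ 0 S x‖ = 1 := by
    rw [← hexp x, eq_neg_of_add_eq_zero_left h1.symm, norm_neg]
  have := hK hx
  nlinarith

/-- The coefficient of `v^>` in the decomposition of `S v^<` into WKB waves. -/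
def coefPlus (α θ x₀ : ℝ) (S : ℝ → ℂ) (x : ℝ) : ℂ :=
  1 + (2 * Complex.I)⁻¹ * ∫ y in x₀..x, (Mfun α θ (max x₀ y) : ℂ) * S (max x₀ y) *
    Complex.exp (2 * Complex.I * (phase α θ y : ℂ))

/-- The coefficient of `v^<` in the decomposition of `S v^<` into WKB waves. -/
def coefMinus (α θ x₀ : ℝ) (S : ℝ → ℂ) (x : ℝ) : ℂ :=
  Rx α θ x₀ S - (2 * Complex.I)⁻¹ * ∫ y in x₀..x, (Mfun α θ (max x₀ y) : ℂ) * S (max x₀ y)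

theorem hasDerivAt_coefPlus {α θ x₀ x : ℝ} {S : ℝ → ℂ} (hα : 0 < α) (hθ : 0 < θ) (hx₀ : 0 < x₀)
    (hS : ContinuousOn S (Ici x₀)) (hx : x₀ ≤ x) :
    HasDerivAt (coefPlus α θ x₀ S) ((2 * Complex.I)⁻¹ * ((Mfun α θ x : ℂ) * S x *
      Complex.exp (2 * Complex.I * (phase α θ x : ℂ)))) x := by
  have h1 := continuous_Mfun_max (α := α) hθ hx₀
  have h2 := continuous_comp_max hS
  have h3 : Continuous (phase α θ) :=
    continuous_iff_continuousAt.2 fun y => (hasDerivAt_phase hα hθ y).continuousAt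
  have h : Continuous fun y => (Mfun α θ (max x₀ y) : ℂ) * S (max x₀ y) *
    Complex.exp (2 * Complex.I * (phase α θ y : ℂ)) :=
    ((Complex.continuous_ofReal.comp h1).mul h2).mul (by fun_prop)
  have := ((h.integral_hasStrictDerivAt x₀ x).hasDerivAt.const_mul (2 * Complex.I)⁻¹).const_add 1
  rwa [max_eq_right hx] at this

theorem hasDerivAt_coefMinus {α θ x₀ x : ℝ} {S : ℝ → ℂ} (hθ : 0 < θ) (hx₀ : 0 < x₀)
    (hS : ContinuousOn S (Ici x₀)) (hx : x₀ ≤ x) :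
    HasDerivAt (coefMinus α θ x₀ S) (-((2 * Complex.I)⁻¹ * ((Mfun α θ x : ℂ) * S x))) x := by
  have h1 := continuous_Mfun_max (α := α) hθ hx₀
  have h2 := continuous_comp_max hS
  have h : Continuous fun y => (Mfun α θ (max x₀ y) : ℂ) * S (max x₀ y) :=
    (Complex.continuous_ofReal.comp h1).mul h2
  have := ((h.integral_hasStrictDerivAt x₀ x).hasDerivAt.const_mul (2 * Complex.I)⁻¹).const_sub
    (Rx α θ x₀ S)
  rwa [max_eq_right hx] at this

theorem IsVolterraSol.mul_vminus_eq {α θ x₀ x : ℝ} {S : ℝ → ℂ} (hα : 0 < α) (hθ : 0 < θ)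
    (hx₀ : 0 < x₀) (hS : IsVolterraSol α θ x₀ S) (hx : x₀ ≤ x) :
    S x * vminus α θ x =
      vplus α θ x * coefPlus α θ x₀ S x + vminus α θ x * coefMinus α θ x₀ S x := by
  obtain ⟨⟨C, hC⟩, hc, heq⟩ := hS
  have hi := integrableOn_Mfun_mul hα hθ hx₀ hC hc
  have hmax : ∀ y ∈ uIcc x₀ x, max x₀ y = y := fun y hy => by
    rw [uIcc_of_le hx] at hy
    exact max_eq_right hy.1
  have h1 : (∫ y in x₀..x, (Mfun α θ y : ℂ) * S y *
      Complex.exp (-2 * Complex.I * ((phase α θ x - phase α θ y : ℝ) : ℂ))) =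
      Complex.exp (-2 * Complex.I * (phase α θ x : ℂ)) *
        ∫ y in x₀..x, (Mfun α θ (max x₀ y) : ℂ) * S (max x₀ y) *
          Complex.exp (2 * Complex.I * (phase α θ y : ℂ)) := by
    rw [← intervalIntegral.integral_const_mul]
    refine intervalIntegral.integral_congr fun y hy => ?_
    have e : -2 * Complex.I * ((phase α θ x - phase α θ y : ℝ) : ℂ) =
        -2 * Complex.I * (phase α θ x : ℂ) + 2 * Complex.I * (phase α θ y : ℂ) := by
      push_cast; ring
    simp only [hmax y hy, e, Complex.exp_add]
    ring
  have h2 : (∫ y in x₀..x, (Mfun α θ (max x₀ y) : ℂ) * S (max x₀ y)) +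
      ∫ y in Ioi x, (Mfun α θ y : ℂ) * S y = ∫ y in Ioi x₀, (Mfun α θ y : ℂ) * S y := by
    rw [← Ioc_union_Ioi_eq_Ioi hx, setIntegral_union (Ioc_disjoint_Ioi le_rfl) measurableSet_Ioi
      (hi.mono_set Ioc_subset_Ioi_self) (hi.mono_set (Ioi_subset_Ioi hx)),
      ← intervalIntegral.integral_of_le hx]
    congr 1
    exact intervalIntegral.integral_congr fun y hy => by simp only [hmax y hy]
  have h3 : vminus α θ x * Complex.exp (-2 * Complex.I * (phase α θ x : ℂ)) = vplus α θ x := by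
    rw [vminus, vplus, mul_assoc, ← Complex.exp_add]
    congr 2
    ring
  rw [heq x hx, Kop_zero, h1, coefPlus, coefMinus, Rx, ← h2, ← h3]
  ring

/-- The derivative of `S v^<`. -/
def solDeriv (α θ x₀ : ℝ) (S : ℝ → ℂ) (x : ℝ) : ℂ :=
  waveDeriv α θ (-Complex.I) x * coefPlus α θ x₀ S x +
    waveDeriv α θ Complex.I x * coefMinus α θ x₀ S x

theorem exp_two_mul_exp_neg (p : ℂ) :
    Complex.exp (2 * Complex.I * p) * Complex.exp (-Complex.I * p) =
      Complex.exp (Complex.I * p) := by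
  rw [← Complex.exp_add]
  congr 1
  ring

theorem IsVolterraSol.hasDerivWithinAt {α θ x₀ x : ℝ} {S : ℝ → ℂ} (hα : 0 < α) (hθ : 0 < θ)
    (hx₀ : 0 < x₀) (hS : IsVolterraSol α θ x₀ S) (hx : x ∈ Ici x₀) :
    HasDerivWithinAt (fun y => S y * vminus α θ y) (solDeriv α θ x₀ S x) (Ici x₀) x := by
  have hx' : 0 < x := hx₀.trans_le hx
  have h := ((hasDerivAt_wave hα hθ hx' (-Complex.I)).fun_mul
    (hasDerivAt_coefPlus hα hθ hx₀ hS.2.1 hx)).fun_add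
    ((hasDerivAt_wave hα hθ hx' Complex.I).fun_mul (hasDerivAt_coefMinus (α := α) hθ hx₀ hS.2.1 hx))
  refine (h.hasDerivWithinAt.congr_of_mem (fun y hy => hS.mul_vminus_eq hα hθ hx₀ hy)
    hx).congr_deriv ?_
  rw [solDeriv, wave, wave]
  linear_combination (amp α θ x : ℂ) * (2 * Complex.I)⁻¹ * (Mfun α θ x : ℂ) * S x *
    exp_two_mul_exp_neg (phase α θ x : ℂ)

theorem IsVolterraSol.hasDerivWithinAt_solDeriv {α θ x₀ x : ℝ} {S : ℝ → ℂ} (hα : 0 < α)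
    (hθ : 0 < θ) (hx₀ : 0 < x₀) (hS : IsVolterraSol α θ x₀ S) (hx : x ∈ Ici x₀) :
    HasDerivWithinAt (solDeriv α θ x₀ S) (-((spd α θ x : ℂ)⁻¹ ^ 2 * (S x * vminus α θ x)))
      (Ici x₀) x := by
  have hx' : 0 < x := hx₀.trans_le hx
  have ha : (amp α θ x : ℂ) ≠ 0 := by exact_mod_cast (amp_pos hθ x).ne'
  have h := ((hasDerivAt_waveDeriv hα hθ hx' (s := -Complex.I) (by simp)).fun_mul
    (hasDerivAt_coefPlus hα hθ hx₀ hS.2.1 hx)).fun_add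
    ((hasDerivAt_waveDeriv hα hθ hx' (s := Complex.I) (by simp)).fun_mul
      (hasDerivAt_coefMinus (α := α) hθ hx₀ hS.2.1 hx))
  refine h.hasDerivWithinAt.congr_deriv ?_
  have hU := hS.mul_vminus_eq hα hθ hx₀ hx
  have hE := exp_two_mul_exp_neg (phase α θ x : ℂ)
  have hM : (Mfun α θ x : ℂ) = (amp α θ x : ℂ) * (ampDeriv₂ α θ x : ℂ) := by
    rw [Mfun_eq hθ hx']; push_cast; rfl
  have hv : vminus α θ x = (amp α θ x : ℂ) * Complex.exp (Complex.I * (phase α θ x : ℂ)) := rfl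
  have key : waveDeriv α θ (-Complex.I) x * ((2 * Complex.I)⁻¹ * ((Mfun α θ x : ℂ) * S x *
        Complex.exp (2 * Complex.I * (phase α θ x : ℂ)))) +
      waveDeriv α θ Complex.I x * -((2 * Complex.I)⁻¹ * ((Mfun α θ x : ℂ) * S x)) =
      -((ampDeriv₂ α θ x : ℂ) / (amp α θ x : ℂ)) * (S x * vminus α θ x) := by
    rw [waveDeriv, waveDeriv, hM, hv, ← hE]
    field_simp
    ring
  rw [← vplus_eq_wave, ← vminus_eq_wave]
  linear_combination key - ((ampDeriv₂ α θ x : ℂ) / (amp α θ x : ℂ) - (spd α θ x : ℂ)⁻¹ ^ 2) * hU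

/-- radiation condition at `x₀` characterizes outgoing solutions. -/
theorem stmt6 (α x₀ : ℝ) (hα : 0 < α) (hx₀ : 0 < x₀) :
    ∃ θ₀ > (0:ℝ), ∀ θ : ℝ, 0 < θ → θ < θ₀ →
      ∀ S : ℝ → ℂ, IsVolterraSol α θ x₀ S →
        vplus α θ x₀ + Rx α θ x₀ S * vminus α θ x₀ ≠ 0 ∧
        S x₀ * vminus α θ x₀ ≠ 0 ∧
        (∀ w w' w'' : ℝ → ℂ,
          (∀ x ∈ Ici x₀, HasDerivWithinAt w (w' x) (Ici x₀) x) →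
          (∀ x ∈ Ici x₀, HasDerivWithinAt w' (w'' x) (Ici x₀) x) →
          (∀ x ∈ Ici x₀, w'' x + ((spd α θ x : ℂ))⁻¹ ^ 2 * w x = 0) →
          ((∃ k : ℂ, ∀ x ∈ Ici x₀, w x = k * (S x * vminus α θ x)) ↔
            w' x₀ * (vplus α θ x₀ + Rx α θ x₀ S * vminus α θ x₀) =
              w x₀ * (deriv (fun y => vplus α θ y) x₀ +
                Rx α θ x₀ S * deriv (fun y => vminus α θ y) x₀))) ∧
        derivWithin (fun y => S y * vminus α θ y) (Ici x₀) x₀ / (S x₀ * vminus α θ x₀) =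
          (deriv (fun y => vplus α θ y) x₀ + Rx α θ x₀ S * deriv (fun y => vminus α θ y) x₀) /
            (vplus α θ x₀ + Rx α θ x₀ S * vminus α θ x₀) := by
  have hev : ∀ᶠ θ in 𝓝[>] (0 : ℝ), Mtail α θ x₀ < 1 :=
    (tendsto_Mtail hα hx₀).eventually_lt_const one_pos
  obtain ⟨θ₀, hθ₀, hsub⟩ := mem_nhdsGT_iff_exists_Ioo_subset.1 hev
  refine ⟨θ₀, hθ₀, fun θ hθ hlt S hS => ?_⟩
  have hM : Mtail α θ x₀ < 1 := hsub ⟨hθ, hlt⟩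
  have hne : ∀ x ∈ Ici x₀, S x * vminus α θ x ≠ 0 := fun x hx =>
    mul_ne_zero (hS.ne_zero hα hθ hx₀ hM x hx)
      (mul_ne_zero (by exact_mod_cast (amp_pos hθ x).ne') (Complex.exp_ne_zero _))
  have hx₀' : x₀ ∈ Ici x₀ := self_mem_Ici
  have hval : S x₀ * vminus α θ x₀ = vplus α θ x₀ + Rx α θ x₀ S * vminus α θ x₀ := by
    rw [hS.mul_vminus_eq hα hθ hx₀ le_rfl, coefPlus, coefMinus]
    simp only [intervalIntegral.integral_same]
    ring
  have hder : solDeriv α θ x₀ S x₀ = deriv (fun y => vplus α θ y) x₀ +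
      Rx α θ x₀ S * deriv (fun y => vminus α θ y) x₀ := by
    have h1 : deriv (fun y => vplus α θ y) x₀ = waveDeriv α θ (-Complex.I) x₀ :=
      (hasDerivAt_wave hα hθ hx₀ (-Complex.I)).deriv
    have h2 : deriv (fun y => vminus α θ y) x₀ = waveDeriv α θ Complex.I x₀ :=
      (hasDerivAt_wave hα hθ hx₀ Complex.I).deriv
    rw [solDeriv, coefPlus, coefMinus, h1, h2]
    simp only [intervalIntegral.integral_same]
    ring
  have huniq : UniqueDiffWithinAt ℝ (Ici x₀) x₀ := uniqueDiffOn_Ici x₀ x₀ hx₀'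
  rw [← hval, ← hder]
  refine ⟨hne x₀ hx₀', hne x₀ hx₀', fun w w' w'' hw hw' hode => ⟨?_, fun h => ?_⟩, ?_⟩
  · rintro ⟨k, hk⟩
    have h1 : HasDerivWithinAt w (k * solDeriv α θ x₀ S x₀) (Ici x₀) x₀ :=
      ((hS.hasDerivWithinAt hα hθ hx₀ hx₀').const_mul k).congr_of_mem hk hx₀'
    rw [huniq.eq_deriv _ (hw x₀ hx₀') h1, hk x₀ hx₀']
    ring
  · exact ⟨_, eq_smul_of_wronskian hw hw' hode
      (fun x hx => hS.hasDerivWithinAt hα hθ hx₀ hx)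
      (fun x hx => hS.hasDerivWithinAt_solDeriv hα hθ hx₀ hx)
      (fun x _ => neg_add_cancel _) hne h⟩
  · rw [(hS.hasDerivWithinAt hα hθ hx₀ hx₀').derivWithin huniq]
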